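/- There exists an integer l⋆(ε) such that S_l ≥ ((1−2ε)³/3 · l)^{3/(1−2ε)} for all integers l ≥ l⋆(ε)/(2ε). -/

import Mathlib

noncomputable section

namespace CubePacking

/-- The side lengths `ℓ_k := k^{−(1+ε)/3}`. -/
def sideLen (ε : ℝ) (k : ℕ) : ℝ := (k : ℝ) ^ (-(1 + ε) / 3)

/-- `L_n^m := ∑_{k=n}^m ℓ_k`, the length needed to put the cubes `n,…,m` in a row. -/
def L (ε : ℝ) (n m : ℕ) : ℝ := ∑ k ∈ Finset.Icc n m, sideLen ε k

/-- `M_n := max{m ≥ n : L_n^m ≤ 1} − n + 1`, the number of cubes, starting from the `n`-th,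
fitting in a row of length `1`.  (The maximum exists for `n ≥ 1` since `ℓ_n ≤ 1` and
`L_n^m → ∞` as `m → ∞`; it is realized here by `sSup`, which coincides with the maximum
of a nonempty bounded-above set of naturals.) -/
def M (ε : ℝ) (n : ℕ) : ℕ := sSup {m : ℕ | n ≤ m ∧ L ε n m ≤ 1} - n + 1

/-- The index `B^n_r` of the first cube of the `r`-th row when rows are started at the `n`-th
cube: `B^n_1 := n` and `B^n_{r+1} := B^n_r + M_{B^n_r}` for `r ≥ 1`. -/
def B (ε : ℝ) (n : ℕ) : ℕ → ℕ
  | 0 => n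
  | 1 => n
  | r + 2 => B ε n (r + 1) + M ε (B ε n (r + 1))

/-- `W_n^R := ∑_{r=1}^R (B^n_r)^{−(1+ε)/3}`, the width occupied by `R` rows starting at the
`n`-th cube. -/
def W (ε : ℝ) (n R : ℕ) : ℝ := ∑ r ∈ Finset.Icc 1 R, (B ε n r : ℝ) ^ (-(1 + ε) / 3)

/-- `R_n := max{R ≥ 1 : W_n^R ≤ 1}`, the number of rows fitting in the unit square starting
from the `n`-th cube.  (Again the maximum is realized by `sSup`.) -/
def Rn (ε : ℝ) (n : ℕ) : ℕ := sSup {R : ℕ | 1 ≤ R ∧ W ε n R ≤ 1}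

/-- `N_n := B^n_{R_n+1} − n + 1`, the number of cubes in those rows. -/
def N (ε : ℝ) (n : ℕ) : ℕ := B ε n (Rn ε n + 1) - n + 1

/-- The index `S_l` of the cube starting the `l`-th vertical layer:
`S_1 := 1` and `S_{l+1} := S_l + N_{S_l}` for `l ≥ 1`. -/
def S (ε : ℝ) : ℕ → ℕ
  | 0 => 1
  | 1 => 1
  | l + 2 => S ε (l + 1) + N ε (S ε (l + 1))

/-- The height `H_l := S_l^{−(1+ε)/3}` of the `l`-th layer. -/
def H (ε : ℝ) (l : ℕ) : ℝ := (S ε l : ℝ) ^ (-(1 + ε) / 3)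

end CubePacking

open CubePacking Filter Topology

namespace CubePacking

lemma sideLen_anti {ε : ℝ} (hε : 0 < ε) {k m : ℕ} (hk : 1 ≤ k) (hkm : k ≤ m) :
    sideLen ε m ≤ sideLen ε k :=
  Real.rpow_le_rpow_of_nonpos (by exact_mod_cast hk) (by exact_mod_cast hkm) (by linarith)

lemma sideLen_le_one {ε : ℝ} (hε : 0 < ε) {k : ℕ} (hk : 1 ≤ k) : sideLen ε k ≤ 1 :=
  Real.rpow_le_one_of_one_le_of_nonpos (by exact_mod_cast hk) (by linarith)

lemma inv_sqrt_le_sideLen {ε : ℝ} (hε : ε < 1 / 2) {k : ℕ} (hk : 1 ≤ k) :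
    (√(k : ℝ))⁻¹ ≤ sideLen ε k := by
  rw [Real.sqrt_eq_rpow, ← Real.rpow_neg (Nat.cast_nonneg k)]
  exact Real.rpow_le_rpow_of_exponent_le (by exact_mod_cast hk) (by linarith)

lemma card_mul_sideLen_le_L {ε : ℝ} (hε : 0 < ε) {n m : ℕ} (hn : 1 ≤ n) :
    ((m + 1 - n : ℕ) : ℝ) * sideLen ε m ≤ L ε n m := by
  have h := Finset.card_nsmul_le_sum (Finset.Icc n m) (sideLen ε) (sideLen ε m) fun k hk => by
    rw [Finset.mem_Icc] at hk
    exact sideLen_anti hε (hn.trans hk.1) hk.2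
  simpa [L, nsmul_eq_mul] using h

lemma L_le_card_mul_sideLen {ε : ℝ} (hε : 0 < ε) {n m : ℕ} (hn : 1 ≤ n) :
    L ε n m ≤ ((m + 1 - n : ℕ) : ℝ) * sideLen ε n := by
  have h := Finset.sum_le_card_nsmul (Finset.Icc n m) (sideLen ε) (sideLen ε n) fun k hk => by
    rw [Finset.mem_Icc] at hk
    exact sideLen_anti hε hn hk.1
  simpa [L, nsmul_eq_mul] using h

/-- A row of length at most `1` ending with the `m`-th cube has at most `√m` cubes. -/
lemma card_le_sqrt {ε : ℝ} (hε0 : 0 < ε) (hε : ε < 1 / 2) {n m : ℕ} (hn : 1 ≤ n)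
    (hnm : n ≤ m) (hL : L ε n m ≤ 1) : ((m + 1 - n : ℕ) : ℝ) ≤ √(m : ℝ) := by
  have hm : (0 : ℝ) < √(m : ℝ) := Real.sqrt_pos.2 (by exact_mod_cast hn.trans hnm)
  have h : ((m + 1 - n : ℕ) : ℝ) * (√(m : ℝ))⁻¹ ≤ 1 :=
    ((mul_le_mul_of_nonneg_left (inv_sqrt_le_sideLen hε (hn.trans hnm))
      (Nat.cast_nonneg _)).trans (card_mul_sideLen_le_L hε0 hn)).trans hL
  rwa [← div_eq_mul_inv, div_le_one hm] at h

lemma bddAbove_row {ε : ℝ} (hε0 : 0 < ε) (hε : ε < 1 / 2) {n : ℕ} (hn : 1 ≤ n) :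
    BddAbove {m : ℕ | n ≤ m ∧ L ε n m ≤ 1} := by
  refine ⟨2 * n, fun m ⟨hnm, hL⟩ => ?_⟩
  have h := card_le_sqrt hε0 hε hn hnm hL
  rw [Nat.cast_sub (by omega)] at h
  push_cast at h
  have hs := Real.sq_sqrt (Nat.cast_nonneg (α := ℝ) m)
  have : (m : ℝ) ≤ 2 * n := by nlinarith [sq_nonneg (√(m : ℝ) - 1)]
  exact_mod_cast this

lemma row_spec {ε : ℝ} (hε0 : 0 < ε) (hε : ε < 1 / 2) {n : ℕ} (hn : 1 ≤ n) :
    ∃ m, n ≤ m ∧ n + M ε n = m + 1 ∧ L ε n m ≤ 1 ∧ 1 < L ε n (m + 1) := by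
  have hb := bddAbove_row hε0 hε hn
  have hmem := Nat.sSup_mem (s := {m : ℕ | n ≤ m ∧ L ε n m ≤ 1})
    ⟨n, le_rfl, by simpa [L] using sideLen_le_one hε0 hn⟩ hb
  refine ⟨sSup {m : ℕ | n ≤ m ∧ L ε n m ≤ 1}, hmem.1, ?_, hmem.2, ?_⟩
  · have := hmem.1
    unfold M
    omega
  · by_contra! hc
    have := le_csSup hb ⟨hmem.1.trans (Nat.le_succ _), hc⟩
    omega

lemma sqrt_add_M_le {ε : ℝ} (hε0 : 0 < ε) (hε : ε < 1 / 2) {n : ℕ} (hn : 1 ≤ n) :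
    √((n + M ε n : ℕ) : ℝ) ≤ √(n : ℝ) + 1 := by
  obtain ⟨m, hnm, hM, hL, -⟩ := row_spec hε0 hε hn
  have h := card_le_sqrt hε0 hε hn hnm hL
  rw [hM]
  rw [Nat.cast_sub (by omega)] at h
  have hmono : √(m : ℝ) ≤ √((m + 1 : ℕ) : ℝ) := Real.sqrt_le_sqrt (by push_cast; linarith)
  have h1 := Real.sq_sqrt (Nat.cast_nonneg (α := ℝ) (m + 1))
  have h2 := Real.sq_sqrt (Nat.cast_nonneg (α := ℝ) n)
  have h3 := Real.sqrt_nonneg (n : ℝ)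
  by_contra! hc
  nlinarith

lemma rpow_sub_one_le_M {ε : ℝ} (hε0 : 0 < ε) (hε : ε < 1 / 2) {n : ℕ} (hn : 1 ≤ n) :
    (n : ℝ) ^ ((1 + ε) / 3) - 1 ≤ M ε n := by
  obtain ⟨m, hnm, hM, -, hL⟩ := row_spec hε0 hε hn
  have h := hL.le.trans (L_le_card_mul_sideLen hε0 hn)
  have hn0 : (0 : ℝ) < n := by exact_mod_cast hn
  rw [show m + 1 + 1 - n = M ε n + 1 by omega, sideLen, neg_div, Real.rpow_neg hn0.le,
    ← div_eq_mul_inv, one_le_div (Real.rpow_pos_of_pos hn0 _)] at h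
  push_cast at h
  linarith

lemma B_succ (ε : ℝ) (n : ℕ) {r : ℕ} (hr : 1 ≤ r) :
    B ε n (r + 1) = B ε n r + M ε (B ε n r) := by
  obtain ⟨r, rfl⟩ := Nat.exists_eq_add_of_le' hr
  rfl

lemma le_B (ε : ℝ) (n r : ℕ) : n ≤ B ε n r := by
  induction r with
  | zero => exact le_rfl
  | succ r ih =>
    rcases Nat.eq_zero_or_pos r with rfl | hr
    · exact le_rfl
    · rw [B_succ ε n hr]; omega

lemma sqrt_B_le {ε : ℝ} (hε0 : 0 < ε) (hε : ε < 1 / 2) {n r : ℕ} (hn : 1 ≤ n) (hr : 1 ≤ r) :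
    √(B ε n r : ℝ) ≤ √(n : ℝ) + r := by
  induction r, hr using Nat.le_induction with
  | base => simp [B]
  | succ r hr ih =>
    rw [B_succ ε n hr]
    have := sqrt_add_M_le hε0 hε (hn.trans (le_B ε n r))
    push_cast at this ⊢
    linarith

lemma W_eq (ε : ℝ) (n R : ℕ) : W ε n R = ∑ r ∈ Finset.range R, sideLen ε (B ε n (r + 1)) := by
  rw [W, Finset.range_eq_Ico, Finset.sum_Ico_add' (fun r => sideLen ε (B ε n r)) 0 R 1]
  rfl

lemma W_succ (ε : ℝ) (n R : ℕ) : W ε n (R + 1) = W ε n R + sideLen ε (B ε n (R + 1)) := by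
  rw [W_eq, W_eq, Finset.sum_range_succ]

lemma tendsto_W {ε : ℝ} (hε0 : 0 < ε) (hε : ε < 1 / 2) {n : ℕ} (hn : 1 ≤ n) :
    Tendsto (W ε n) atTop atTop := by
  have hs : 0 < √(n : ℝ) + 1 := by positivity
  refine tendsto_atTop_mono (fun R => ?_)
    (Real.tendsto_sum_range_one_div_nat_succ_atTop.const_mul_atTop (inv_pos.2 hs))
  rw [W_eq, Finset.mul_sum]
  refine Finset.sum_le_sum fun r _ => ?_
  have hB : 1 ≤ B ε n (r + 1) := hn.trans (le_B ε n _)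
  refine le_trans ?_ (inv_sqrt_le_sideLen hε hB)
  rw [one_div, ← mul_inv]
  refine inv_anti₀ (Real.sqrt_pos.2 (by exact_mod_cast hB)) ?_
  have := sqrt_B_le hε0 hε hn (Nat.le_add_left 1 r)
  push_cast at this
  nlinarith [mul_nonneg (Real.sqrt_nonneg (n : ℝ)) (Nat.cast_nonneg (α := ℝ) r)]

lemma one_lt_W_Rn_succ {ε : ℝ} (hε0 : 0 < ε) (hε : ε < 1 / 2) {n : ℕ} (hn : 1 ≤ n) :
    1 < W ε n (Rn ε n + 1) := by
  obtain ⟨K, hK⟩ := eventually_atTop.1 ((tendsto_W hε0 hε hn).eventually_gt_atTop 1)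
  have hb : BddAbove {R : ℕ | 1 ≤ R ∧ W ε n R ≤ 1} :=
    ⟨K, fun R hR => by by_contra! hc; exact absurd hR.2 (hK R hc.le).not_ge⟩
  by_contra! hc
  have h := le_csSup hb ⟨Nat.le_add_left 1 (Rn ε n), hc⟩
  change Rn ε n + 1 ≤ Rn ε n at h
  omega

lemma one_sub_sideLen_le_W_Rn {ε : ℝ} (hε0 : 0 < ε) (hε : ε < 1 / 2) {n : ℕ} (hn : 1 ≤ n) :
    1 - sideLen ε n ≤ W ε n (Rn ε n) := by
  have h := one_lt_W_Rn_succ hε0 hε hn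
  rw [W_succ] at h
  linarith [sideLen_anti hε0 hn (le_B ε n (Rn ε n + 1))]

/-- Tangent line bound at the right endpoint for the concave function `t ↦ t ^ δ`. -/
lemma mul_rpow_sub_one_le_rpow_sub {b x δ : ℝ} (hb : 0 < b) (hx : 0 ≤ x) (hδ0 : 0 ≤ δ)
    (hδ1 : δ ≤ 1) : δ * x * (b + x) ^ (δ - 1) ≤ (b + x) ^ δ - b ^ δ := by
  have hy : 0 < b + x := by linarith
  have h := rpow_one_add_le_one_add_mul_self (s := -(x / (b + x)))
    (neg_le_neg ((div_le_one hy).2 (by linarith))) hδ0 hδ1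
  rw [show 1 + -(x / (b + x)) = b / (b + x) by field_simp; ring,
    Real.div_rpow hb.le hy.le, div_le_iff₀ (Real.rpow_pos_of_pos hy _)] at h
  rw [Real.rpow_sub_one hy.ne']
  have : (1 + δ * -(x / (b + x))) * (b + x) ^ δ =
      (b + x) ^ δ - δ * x * ((b + x) ^ δ / (b + x)) := by ring
  linarith

lemma eventually_le_tangent {a c : ℝ} (ha0 : 0 < a) (ha1 : a < 1) (hc : c < 1) :
    ∀ᶠ x : ℝ in atTop, c * x ^ (-a) ≤ (x ^ a - 1) * (x + (x ^ a - 1)) ^ (-(2 * a)) := by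
  have h1 : Tendsto (fun x : ℝ => (1 - x ^ (-a)) * (1 + x ^ (-(1 - a))) ^ (-(2 * a))) atTop
      (𝓝 ((1 - 0) * (1 + 0) ^ (-(2 * a)))) :=
    ((tendsto_rpow_neg_atTop ha0).const_sub 1).mul
      (((tendsto_rpow_neg_atTop (sub_pos.2 ha1)).const_add 1).rpow_const (Or.inl (by norm_num)))
  simp only [sub_zero, add_zero, Real.one_rpow, mul_one] at h1
  filter_upwards [h1.eventually_const_lt hc, eventually_ge_atTop 1] with x hx hx1
  have hx0 : 0 < x := by linarith
  have hxa : 1 ≤ x ^ a := Real.one_le_rpow hx1 ha0.le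
  calc c * x ^ (-a)
      ≤ (1 - x ^ (-a)) * (1 + x ^ (-(1 - a))) ^ (-(2 * a)) * x ^ (-a) := by gcongr
    _ = (x ^ a - 1) * (x + x ^ a) ^ (-(2 * a)) := by
        have e1 : x + x ^ a = x * (1 + x ^ (-(1 - a))) := by
          rw [mul_add, mul_one, ← Real.rpow_one_add' hx0.le (by linarith)]
          congr 2; ring
        have e2 : x ^ (-(2 * a)) = x ^ (-a) * x ^ (-a) := by
          rw [← Real.rpow_add hx0]; congr 1; ring
        have e3 : x ^ a * x ^ (-a) = 1 := by
          rw [← Real.rpow_add hx0]; simp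
        rw [e1, Real.mul_rpow hx0.le (by positivity), e2]
        linear_combination (-(1 + x ^ (-(1 - a))) ^ (-(2 * a)) * x ^ (-a)) * e3
    _ ≤ (x ^ a - 1) * (x + (x ^ a - 1)) ^ (-(2 * a)) :=
        mul_le_mul_of_nonneg_left
          (Real.rpow_le_rpow_of_nonpos (by linarith) (by linarith) (by linarith)) (by linarith)

/-- Eventually, each row increases the `(1 - 2ε) / 3`-th power of the index almost
proportionally to the width of the row. -/
lemma eventually_row_increment {ε c : ℝ} (hε0 : 0 < ε) (hε : ε < 1 / 2) (hc : c < 1) :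
    ∀ᶠ n : ℕ in atTop, (n : ℝ) ^ ((1 - 2 * ε) / 3) + (1 - 2 * ε) / 3 * c * sideLen ε n ≤
      ((n + M ε n : ℕ) : ℝ) ^ ((1 - 2 * ε) / 3) := by
  have h := eventually_le_tangent (a := (1 + ε) / 3) (by linarith) (by linarith) hc
  filter_upwards [tendsto_natCast_atTop_atTop.eventually h, eventually_ge_atTop 1] with n hn hn1
  have hn0 : (0 : ℝ) < n := by exact_mod_cast hn1
  have hx : 0 ≤ (n : ℝ) ^ ((1 + ε) / 3) - 1 :=
    sub_nonneg.2 (Real.one_le_rpow (by exact_mod_cast hn1) (by linarith))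
  have ht := mul_rpow_sub_one_le_rpow_sub hn0 hx (δ := (1 - 2 * ε) / 3) (by linarith)
    (by linarith)
  rw [show (1 - 2 * ε) / 3 - 1 = -(2 * ((1 + ε) / 3)) by ring] at ht
  have hm : ((n : ℝ) + ((n : ℝ) ^ ((1 + ε) / 3) - 1)) ^ ((1 - 2 * ε) / 3) ≤
      ((n + M ε n : ℕ) : ℝ) ^ ((1 - 2 * ε) / 3) := by
    refine Real.rpow_le_rpow (by linarith) ?_ (by linarith)
    push_cast
    linarith [rpow_sub_one_le_M hε0 hε hn1]
  have hd : 0 ≤ (1 - 2 * ε) / 3 := by linarith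
  have := mul_le_mul_of_nonneg_left hn hd
  rw [sideLen, neg_div]
  nlinarith

lemma B_succ_le_add_N (ε : ℝ) (n : ℕ) : B ε n (Rn ε n + 1) ≤ n + N ε n := by
  unfold N
  omega

/-- Eventually, each layer increases the `(1 - 2ε) / 3`-th power of the index by almost
`(1 - 2ε) / 3`. -/
lemma eventually_layer_increment {ε c : ℝ} (hε0 : 0 < ε) (hε : ε < 1 / 2) (hc0 : 0 ≤ c)
    (hc : c < 1) :
    ∀ᶠ n : ℕ in atTop, (n : ℝ) ^ ((1 - 2 * ε) / 3) + (1 - 2 * ε) / 3 * c ^ 2 ≤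
      ((n + N ε n : ℕ) : ℝ) ^ ((1 - 2 * ε) / 3) := by
  obtain ⟨n₀, hn₀⟩ := eventually_atTop.1 (eventually_row_increment hε0 hε hc)
  have hlim : Tendsto (fun n : ℕ => sideLen ε n) atTop (𝓝 0) := by
    have := (tendsto_rpow_neg_atTop (y := (1 + ε) / 3) (by linarith)).comp
      (tendsto_natCast_atTop_atTop (R := ℝ))
    simpa only [sideLen, neg_div, Function.comp_def] using this
  filter_upwards [hlim.eventually_lt_const (sub_pos.2 hc), eventually_ge_atTop n₀,
    eventually_ge_atTop 1] with n hs hn hn1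
  have hsum (R : ℕ) : (n : ℝ) ^ ((1 - 2 * ε) / 3) + (1 - 2 * ε) / 3 * c * W ε n R ≤
      (B ε n (R + 1) : ℝ) ^ ((1 - 2 * ε) / 3) := by
    induction R with
    | zero => simp [W, B]
    | succ R ih =>
      have h := hn₀ _ (hn.trans (le_B ε n (R + 1)))
      rw [W_succ, B_succ ε n (Nat.le_add_left 1 R)]
      linarith
  have hW := one_sub_sideLen_le_W_Rn hε0 hε hn1
  have hd : 0 ≤ (1 - 2 * ε) / 3 * c := mul_nonneg (by linarith) hc0
  calc (n : ℝ) ^ ((1 - 2 * ε) / 3) + (1 - 2 * ε) / 3 * c ^ 2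
      = (n : ℝ) ^ ((1 - 2 * ε) / 3) + (1 - 2 * ε) / 3 * c * c := by ring
    _ ≤ (n : ℝ) ^ ((1 - 2 * ε) / 3) + (1 - 2 * ε) / 3 * c * W ε n (Rn ε n) := by
        gcongr
        linarith
    _ ≤ _ := hsum _
    _ ≤ _ := Real.rpow_le_rpow (Nat.cast_nonneg _) (by exact_mod_cast B_succ_le_add_N ε n)
        (by linarith)

lemma S_succ (ε : ℝ) {l : ℕ} (hl : 1 ≤ l) : S ε (l + 1) = S ε l + N ε (S ε l) := by
  obtain ⟨l, rfl⟩ := Nat.exists_eq_add_of_le' hl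
  rfl

lemma le_S (ε : ℝ) (l : ℕ) : l ≤ S ε l := by
  induction l with
  | zero => exact Nat.zero_le _
  | succ l ih =>
    rcases Nat.eq_zero_or_pos l with rfl | hl
    · exact le_rfl
    · rw [S_succ ε hl]
      unfold N
      omega

end CubePacking

open CubePacking in
/-- Simplified lower bound on `S_l`.
There exists `l⋆(ε)` such that `S_l ≥ ((1−2ε)³/3 · l)^{3/(1−2ε)}` for all integers
`l ≥ l⋆(ε)/(2ε)`. -/
theorem S_lower_bound_simple (ε : ℝ) (hε0 : 0 < ε) (hε : ε < 1 / 2) :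
    ∃ lst : ℕ, ∀ l : ℕ, (lst : ℝ) / (2 * ε) ≤ (l : ℝ) →
      ((1 - 2 * ε) ^ 3 / 3 * (l : ℝ)) ^ (3 / (1 - 2 * ε)) ≤ (S ε l : ℝ) := by
  obtain ⟨n₀, hn₀⟩ := eventually_atTop.1 ((eventually_layer_increment hε0 hε
    (c := 1 - ε) (by linarith) (by linarith)).and (eventually_ge_atTop 1))
  have hn₀1 : 1 ≤ n₀ := (hn₀ n₀ le_rfl).2
  have hd : 0 < (1 - 2 * ε) / 3 := by linarith
  set q := (1 - 2 * ε) / 3 * (1 - ε) ^ 2 with hq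
  have hpq : (1 - 2 * ε) ^ 3 / 3 < q := by
    have : (1 - 2 * ε) ^ 2 < (1 - ε) ^ 2 := by nlinarith
    rw [hq]
    nlinarith
  have hS (l : ℕ) (hl : n₀ ≤ l) : q * ((l : ℝ) - n₀) ≤ (S ε l : ℝ) ^ ((1 - 2 * ε) / 3) := by
    induction l, hl using Nat.le_induction with
    | base => simp only [sub_self, mul_zero]; positivity
    | succ l hl ih =>
      have h := (hn₀ _ (hl.trans (le_S ε l))).1
      rw [S_succ ε (hn₀1.trans hl)]
      push_cast at h ⊢
      linarith
  obtain ⟨K, hK⟩ := exists_nat_ge (q * n₀ / (q - (1 - 2 * ε) ^ 3 / 3))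
  refine ⟨max n₀ K, fun l hl => ?_⟩
  have hle : ((max n₀ K : ℕ) : ℝ) ≤ l :=
    (le_div_self (Nat.cast_nonneg _) (by linarith) (by linarith)).trans hl
  have hle : max n₀ K ≤ l := by exact_mod_cast hle
  have hKl : (K : ℝ) ≤ l := by exact_mod_cast (le_max_right _ _).trans hle
  have h := hS l ((le_max_left _ _).trans hle)
  have hlin := (div_le_iff₀ (sub_pos.2 hpq)).1 (hK.trans hKl)
  have hp : 0 ≤ (1 - 2 * ε) ^ 3 / 3 * (l : ℝ) := by
    have : 0 < 1 - 2 * ε := by linarith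
    positivity
  rw [show 3 / (1 - 2 * ε) = ((1 - 2 * ε) / 3)⁻¹ by rw [inv_div],
    Real.rpow_inv_le_iff_of_pos hp (Nat.cast_nonneg _) hd]
  linarith
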